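/- Let (M, P_M) be a Nijenhuis bimodule over a Nijenhuis algebra (A, P_A). Then M equipped with the deformed actions ▷, ◁ and the operator P_M is a Nijenhuis bimodule over the Nijenhuis algebra (A, ·_P, P_A); in particular, for all x ∈ A and m ∈ M: P_A(x) ▷ P_M(m) = P_M(P_A(x) ▷ m + x ▷ P_M(m) − P_M(x ▷ m)) and P_M(m) ◁ P_A(x) = P_M(P_M(m) ◁ x + m ◁ P_A(x) − P_M(m ◁ x)). -/

import Mathlib

/-- The Nijenhuis operator condition on an associative algebra. -/
def IsNijenhuis {A : Type*} [Ring A] (P : A → A) : Prop :=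
  ∀ x y : A, P x * P y = P (P x * y + x * P y - P (x * y))

/-- The deformed product `x ·_P y := P x * y + x * P y - P (x * y)`. -/
def dmul {A : Type*} [Ring A] (P : A → A) (x y : A) : A :=
  P x * y + x * P y - P (x * y)

/-- A bimodule structure over an associative algebra `A`, with `l x m = x·m`
and `r x m = m·x`. -/
structure BimoduleStr (k A M : Type*) [Field k] [Ring A] [Algebra k A]
    [AddCommGroup M] [Module k M] where
  l : A →ₗ[k] M →ₗ[k] M
  r : A →ₗ[k] M →ₗ[k] M
  l_mul : ∀ (x y : A) (m : M), l (x * y) m = l x (l y m)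
  r_mul : ∀ (x y : A) (m : M), r (x * y) m = r y (r x m)
  lr : ∀ (x y : A) (m : M), r y (l x m) = l x (r y m)

def actL {k A M : Type*} [Field k] [Ring A] [Algebra k A] [AddCommGroup M] [Module k M]
    (ρ : BimoduleStr k A M) : A → M → M := fun a m => ρ.l a m

def actR {k A M : Type*} [Field k] [Ring A] [Algebra k A] [AddCommGroup M] [Module k M]
    (ρ : BimoduleStr k A M) : A → M → M := fun a m => ρ.r a m

/-- `(M, PM)` is a Nijenhuis bimodule over the Nijenhuis algebra `(A, P)`. -/
def IsNijBimodule {k A M : Type*} [Field k] [Ring A] [Algebra k A]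
    [AddCommGroup M] [Module k M] (P : A →ₗ[k] A) (ρ : BimoduleStr k A M)
    (PM : M →ₗ[k] M) : Prop :=
  (∀ (x : A) (m : M), ρ.l (P x) (PM m) = PM (ρ.l (P x) m + ρ.l x (PM m) - PM (ρ.l x m))) ∧
  (∀ (x : A) (m : M), ρ.r (P x) (PM m) = PM (ρ.r x (PM m) + ρ.r (P x) m - PM (ρ.r x m)))

/-- The deformed left action `x ▷ m := P(x)·m + x·PM(m) - PM(x·m)`. -/
def dL {A M : Type*} [AddCommGroup M] (P : A → A) (PM : M → M)
    (l : A → M → M) (x : A) (m : M) : M :=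
  l (P x) m + l x (PM m) - PM (l x m)

/-- The deformed right action `m ◁ x := PM(m)·x + m·P(x) - PM(m·x)`. -/
def dR {A M : Type*} [AddCommGroup M] (P : A → A) (PM : M → M)
    (r : A → M → M) (x : A) (m : M) : M :=
  r x (PM m) + r (P x) m - PM (r x m)

/-- `(M, ▷, ◁, PM)` is a Nijenhuis bimodule over the Nijenhuis
algebra `(A, ·_P, P)`; in particular the two displayed Nijenhuis-bimodule
identities hold for the deformed actions. -/
theorem deformed_actions_nijenhuis_bimodule {k A M : Type*} [Field k] [Ring A]
    [Algebra k A] [AddCommGroup M] [Module k M]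
    (P : A →ₗ[k] A) (hP : IsNijenhuis (⇑P))
    (ρ : BimoduleStr k A M) (PM : M →ₗ[k] M)
    (hMod : IsNijBimodule P ρ PM) :
    (∀ (x y : A) (m : M),
        dL (⇑P) (⇑PM) (actL ρ) (dmul (⇑P) x y) m
          = dL (⇑P) (⇑PM) (actL ρ) x (dL (⇑P) (⇑PM) (actL ρ) y m))
    ∧ (∀ (x y : A) (m : M),
        dR (⇑P) (⇑PM) (actR ρ) (dmul (⇑P) x y) m
          = dR (⇑P) (⇑PM) (actR ρ) y (dR (⇑P) (⇑PM) (actR ρ) x m))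
    ∧ (∀ (x y : A) (m : M),
        dR (⇑P) (⇑PM) (actR ρ) y (dL (⇑P) (⇑PM) (actL ρ) x m)
          = dL (⇑P) (⇑PM) (actL ρ) x (dR (⇑P) (⇑PM) (actR ρ) y m))
    ∧ (∀ (x : A) (m : M),
        dL (⇑P) (⇑PM) (actL ρ) (P x) (PM m)
          = PM (dL (⇑P) (⇑PM) (actL ρ) (P x) m
              + dL (⇑P) (⇑PM) (actL ρ) x (PM m)
              - PM (dL (⇑P) (⇑PM) (actL ρ) x m)))
    ∧ (∀ (x : A) (m : M),
        dR (⇑P) (⇑PM) (actR ρ) (P x) (PM m)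
          = PM (dR (⇑P) (⇑PM) (actR ρ) x (PM m)
              + dR (⇑P) (⇑PM) (actR ρ) (P x) m
              - PM (dR (⇑P) (⇑PM) (actR ρ) x m))) := by
  have hmul (x y : A) : P (P x * y) = P x * P y - P (x * P y) + P (P (x * y)) := by
    have h := hP x y
    simp only [map_add, map_sub] at h
    rw [h]
    abel
  obtain ⟨hL, hR⟩ := hMod
  simp only [map_add, map_sub] at hL hR
  simp only [dL, dR, dmul, actL, actR]
  refine ⟨?_, ?_, ?_, ?_, ?_⟩
  · intro x y m
    simp only [map_add, map_sub, LinearMap.add_apply, LinearMap.sub_apply, hmul, ρ.l_mul, hL]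
    abel
  · intro x y m
    simp only [map_add, map_sub, LinearMap.add_apply, LinearMap.sub_apply, hmul, ρ.r_mul, hR]
    abel
  · intro x y m
    have h := congrArg (ρ.r y) (hL x m)
    simp only [map_add, map_sub, ρ.lr] at h
    simp only [map_add, map_sub, ρ.lr, hL, hR, h]
    abel
  · intro x m
    simp only [map_add, map_sub, hL]
  · intro x m
    simp only [map_add, map_sub, hR]
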